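/- arXiv:0804.2049 — 8 statements merged into one kernel-verified Lean document; each statement's English description precedes it below -/
import Mathlib

section
/- In the Zorn vector-matrix algebra C(F) over a field F, the norm is multiplicative: for all a, b in C(F), n(a ∘ b) = n(a) · n(b). -/
/-- Underlying set of the Zorn vector-matrix (split Cayley–Dickson) algebra over `F`:
an element `(α₁, α₁₂, α₂₁, α₂)` is the 2×2 matrix with scalar diagonal entries
`α₁, α₂` and vector off-diagonal entries `α₁₂, α₂₁`. -/
abbrev ZornAlg (F : Type*) : Type _ := F × (Fin 3 → F) × (Fin 3 → F) × F

/-- Dot product on `Fin 3 → F`. -/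
def dot3 {F : Type*} [Field F] (x y : Fin 3 → F) : F := ∑ i, x i * y i

/-- Cross product on `Fin 3 → F`. -/
def cross3 {F : Type*} [Field F] (x y : Fin 3 → F) : Fin 3 → F :=
  ![x 1 * y 2 - x 2 * y 1, x 2 * y 0 - x 0 * y 2, x 0 * y 1 - x 1 * y 0]

/-- Zorn vector-matrix multiplication. -/
def zmul {F : Type*} [Field F] (a b : ZornAlg F) : ZornAlg F :=
  (a.1 * b.1 + dot3 a.2.1 b.2.2.1,
   a.1 • b.2.1 + b.2.2.2 • a.2.1 - cross3 a.2.2.1 b.2.2.1,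
   b.1 • a.2.2.1 + a.2.2.2 • b.2.2.1 + cross3 a.2.1 b.2.1,
   a.2.2.2 * b.2.2.2 + dot3 a.2.2.1 b.2.1)

/-- The unit `1 = (1, 0, 0, 1)` of the Zorn algebra. -/
def zornOne (F : Type*) [Field F] : ZornAlg F := (1, 0, 0, 1)

/-- Trace `t(a) = α₁ + α₂`. -/
def ztrace {F : Type*} [Field F] (a : ZornAlg F) : F := a.1 + a.2.2.2

/-- Norm `n(a) = α₁ α₂ − α₁₂ ⋅ α₂₁`. -/
def znorm {F : Type*} [Field F] (a : ZornAlg F) : F := a.1 * a.2.2.2 - dot3 a.2.1 a.2.2.1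

/-- The norm of the Zorn algebra is multiplicative: `n(a ∘ b) = n(a) ⬝ n(b)`. -/
theorem zorn_norm_mul {F : Type*} [Field F] (a b : ZornAlg F) :
    znorm (zmul a b) = znorm a * znorm b := by
  simp only [znorm, zmul, dot3, cross3, Fin.sum_univ_three, Pi.add_apply, Pi.sub_apply, Pi.smul_apply,
    smul_eq_mul, Matrix.cons_val]
  ring
end

section
/- The Zorn vector-matrix algebra C(F) over a field F is alternative: for all a, b in C(F), (a ∘ a) ∘ b = a ∘ (a ∘ b) and a ∘ (b ∘ b) = (a ∘ b) ∘ b. -/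
/-- The Zorn vector-matrix algebra is alternative:
`(a ∘ a) ∘ b = a ∘ (a ∘ b)` and `a ∘ (b ∘ b) = (a ∘ b) ∘ b`. -/
theorem zorn_alternative {F : Type*} [Field F] (a b : ZornAlg F) :
    zmul (zmul a a) b = zmul a (zmul a b) ∧ zmul a (zmul b b) = zmul (zmul a b) b := by
  obtain ⟨a₁, u, v, a₂⟩ := a
  obtain ⟨b₁, x, y, b₂⟩ := b
  constructor <;>
    refine Prod.ext ?_ (Prod.ext (funext fun i => ?_) (Prod.ext (funext fun i => ?_) ?_))
  all_goals try fin_cases i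
  all_goals
    simp only [zmul, dot3, cross3, Fin.sum_univ_three, Pi.add_apply, Pi.sub_apply, Pi.smul_apply,
      smul_eq_mul, Fin.zero_eta, Fin.mk_one, Fin.reduceFinMk, Matrix.cons_val]
    ring
end

section
/- Let F be a field with char F ≠ 2. An element a of the Zorn vector-matrix algebra C(F) commutes with every element of C(F) (i.e. a ∘ b = b ∘ a for all b) if and only if a is a scalar matrix, i.e. a = (α, 0, 0, α) for some α ∈ F. -/
/-- For `char F ≠ 2`, an element of the Zorn algebra commutes with every element iff it is
a scalar matrix `(α, 0, 0, α)`. -/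
theorem zorn_central_iff_scalar {F : Type*} [Field F] (hchar : ringChar F ≠ 2)
    (a : ZornAlg F) :
    (∀ b : ZornAlg F, zmul a b = zmul b a) ↔ ∃ α : F, a = (α, 0, 0, α) := by
  constructor
  · intro h
    obtain ⟨p, u, v, q⟩ := a
    have hdiag := h (1, 0, 0, 0)
    have hoff := h (0, ![1, 0, 0], 0, 0)
    simp only [zmul, Prod.mk.injEq] at hdiag hoff
    have hu : u = 0 := by
      funext i
      have := congrFun hdiag.2.1 i
      fin_cases i <;> simpa [cross3] using this.symm
    have hv : v = 0 := by
      funext i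
      have := congrFun hdiag.2.2.1 i
      fin_cases i <;> simpa [cross3] using this
    subst hu hv
    have hpq : p = q := by
      simpa [cross3] using congrFun hoff.2.1 0
    exact ⟨p, by rw [hpq]⟩
  · rintro ⟨α, rfl⟩ ⟨p, u, v, q⟩
    simp only [zmul, Prod.mk.injEq]
    refine ⟨?_, ?_, ?_, ?_⟩
    · simp [dot3, mul_comm]
    · funext i
      fin_cases i <;> simp [cross3]
    · funext i
      fin_cases i <;> simp [cross3]
    · simp [dot3, mul_comm]
end

section
/- Let F be a field with char F ≠ 2. If an element a of the Zorn vector-matrix algebra C(F) has norm n(a) = 1 and commutes with every element of C(F) (i.e. a ∘ b = b ∘ a for all b), then a = 1 or a = −1. (Thus the center of the norm-one loop M₀(F) is the cyclic group generated by −1.) -/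
/-- For `char F ≠ 2`, a norm-one element of the Zorn algebra commuting with every element
is `1` or `−1`; thus the center of the norm-one loop `M₀(F)` is `⟨−1⟩`. -/
theorem zorn_center_norm_one {F : Type*} [Field F] (hchar : ringChar F ≠ 2)
    (a : ZornAlg F) (hnorm : znorm a = 1)
    (hcomm : ∀ b : ZornAlg F, zmul a b = zmul b a) :
    a = zornOne F ∨ a = -zornOne F := by
  obtain ⟨α, u, v, β⟩ := a
  have hdiag := hcomm (1, 0, 0, 0)
  have hoff := hcomm (0, Pi.single 0 1, 0, 0)
  simp only [zmul, Prod.mk.injEq] at hdiag hoff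
  have hu : u = 0 := by
    ext i
    have h := congrFun hdiag.2.1 i
    fin_cases i <;> simpa [cross3] using h.symm
  have hv : v = 0 := by
    ext i
    have h := congrFun hdiag.2.2.1 i
    fin_cases i <;> simpa [cross3] using h
  subst hu hv
  have hαβ : α = β := by simpa [cross3] using congrFun hoff.2.1 0
  subst hαβ
  have hsq : α * α = 1 := by simpa [znorm, dot3] using hnorm
  rcases mul_self_eq_one_iff.mp hsq with rfl | rfl
  · exact Or.inl rfl
  · exact Or.inr (by simp [zornOne])
end

section
/- In a unital alternative ring A, the inverse of a product is the product of the inverses in reverse order: if x, x', y, y' in A satisfy x * x' = 1, x' * x = 1, y * y' = 1, y' * y = 1, then (x * y) * (y' * x') = 1 and (y' * x') * (x * y) = 1. -/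
section Alternative

variable {A : Type*} [NonAssocRing A]

theorem left_alternative_linearized (hl : ∀ x y : A, (x * x) * y = x * (x * y)) (a b c : A) :
    (a * b) * c + (b * a) * c = a * (b * c) + b * (a * c) := by
  have h := hl (a + b) c
  simp only [add_mul, mul_add, hl] at h
  linear_combination (norm := abel) h

theorem right_alternative_linearized (hr : ∀ x y : A, (y * x) * x = y * (x * x)) (a b c : A) :
    (a * b) * c + (a * c) * b = a * (b * c) + a * (c * b) := by
  have h := hr (b + c) a
  simp only [add_mul, mul_add, hr] at h
  linear_combination (norm := abel) h

/-- The left Moufang identity in an alternative ring. -/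
theorem left_moufang_of_alternative
    (hl : ∀ x y : A, (x * x) * y = x * (x * y))
    (hr : ∀ x y : A, (y * x) * x = y * (x * x)) (x y z : A) :
    ((x * y) * x) * z = x * (y * (x * z)) := by
  have h₁ := left_alternative_linearized hl (x * y) x z
  have h₂ := right_alternative_linearized hr x y (x * z)
  have h₃ := right_alternative_linearized hr (x * x) y z
  have h₄ := congrArg (x * ·) (right_alternative_linearized hr x y z)
  simp only [hl, mul_add] at h₁ h₂ h₃ h₄
  linear_combination (norm := abel) h₁ + h₂ - h₃ + h₄

/-- The left inverse property in an alternative ring. -/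
theorem inv_mul_cancel_left_of_alternative
    (hl : ∀ x y : A, (x * x) * y = x * (x * y))
    (hr : ∀ x y : A, (y * x) * x = y * (x * x)) {x x' : A}
    (hx : x * x' = 1) (hx' : x' * x = 1) (z : A) : x' * (x * z) = z := by
  have inj : Function.Injective (x * ·) := by
    intro a b h
    have key (c : A) : x * (x' * (x' * (x * c))) = c := by
      rw [← hl x', ← left_moufang_of_alternative hl hr, ← hr, hx, one_mul, hx', one_mul]
    rw [← key a, ← key b]
    exact congrArg (fun t => x * (x' * (x' * t))) h
  apply inj
  change x * (x' * (x * z)) = x * z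
  rw [← left_moufang_of_alternative hl hr, hx, one_mul]

/-- The right inverse property in an alternative ring. -/
theorem mul_inv_cancel_right_of_alternative
    (hl : ∀ x y : A, (x * x) * y = x * (x * y))
    (hr : ∀ x y : A, (y * x) * x = y * (x * x)) {x x' : A}
    (hx : x * x' = 1) (hx' : x' * x = 1) (z : A) : (z * x) * x' = z := by
  have h₁ := left_alternative_linearized hl z x x'
  have h₂ := right_alternative_linearized hr x z x'
  have h₃ := inv_mul_cancel_left_of_alternative hl hr hx' hx z
  rw [hx, mul_one] at h₁
  rw [hx, one_mul, h₃] at h₂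
  linear_combination (norm := abel) h₁ - h₂

theorem mul_mul_inv_rev_of_alternative
    (hl : ∀ x y : A, (x * x) * y = x * (x * y))
    (hr : ∀ x y : A, (y * x) * x = y * (x * x)) {x x' y y' : A}
    (hx : x * x' = 1) (hx' : x' * x = 1) (hy : y * y' = 1) (hy' : y' * y = 1) :
    (x * y) * (y' * x') = 1 := by
  have h₁ := left_alternative_linearized hl x' (x * y) y'
  have h₂ := right_alternative_linearized hr (x * y) x' y'
  rw [inv_mul_cancel_left_of_alternative hl hr hx hx',
    mul_inv_cancel_right_of_alternative hl hr hy hy', hy, hx'] at h₁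
  rw [mul_inv_cancel_right_of_alternative hl hr hy hy', hx] at h₂
  linear_combination (norm := abel) h₁ - h₂

end Alternative


/-- In a unital alternative ring, the inverse of a product is the product of the inverses
in reverse order. -/
theorem alternative_inv_mul_rev {A : Type*} [NonAssocRing A]
    (hl : ∀ x y : A, (x * x) * y = x * (x * y))
    (hr : ∀ x y : A, (y * x) * x = y * (x * x))
    (x x' y y' : A)
    (hx : x * x' = 1) (hx' : x' * x = 1) (hy : y * y' = 1) (hy' : y' * y = 1) :
    (x * y) * (y' * x') = 1 ∧ (y' * x') * (x * y) = 1 := by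
  exact ⟨mul_mul_inv_rev_of_alternative hl hr hx hx' hy hy',
    mul_mul_inv_rev_of_alternative hl hr hy' hy hx' hx⟩
end

section
/- (Associator formula, Lemma 12.) Let A be a unital alternative ring, m a natural number, and u, v, w in A with u^[m] = 0, v^[m] = 0, w^[m] = 0 (right-normed powers). Set a = 1 − u, b = 1 − v, c = 1 − w, Su = ∑_{i < m} u^[i], Sv = ∑_{i < m} v^[i], Sw = ∑_{i < m} w^[i]. Then the loop associator of a, b, c in the loop of invertible elements of A satisfies: (a * (b * c)) * (1 − ((Sw * Sv) * Su) * ((u * v) * w − u * (v * w))) = (a * b) * c. -/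
namespace AlternativeRing

variable {A : Type*} [NonAssocRing A]

theorem mul_linearized_left (hl : ∀ x y : A, (x * x) * y = x * (x * y)) (x y z : A) :
    (x * y) * z + (y * x) * z = x * (y * z) + y * (x * z) := by
  have h := hl (x + y) z
  simp only [add_mul, mul_add, hl] at h
  rw [← sub_eq_zero] at h ⊢
  rw [← h]
  abel

theorem mul_linearized_right (hr : ∀ x y : A, (y * x) * x = y * (x * x)) (x y z : A) :
    (x * y) * z + (x * z) * y = x * (y * z) + x * (z * y) := by
  have h := hr (y + z) x
  simp only [add_mul, mul_add, hr] at h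
  rw [← sub_eq_zero] at h ⊢
  rw [← h]
  abel

theorem associator_swap_left (hl : ∀ x y : A, (x * x) * y = x * (x * y)) (x y z : A) :
    associator y x z = -associator x y z := by
  have h := mul_linearized_left hl x y z
  simp only [associator_apply]
  rw [← sub_eq_zero] at h ⊢
  rw [← h]
  abel

theorem associator_swap_right (hr : ∀ x y : A, (y * x) * x = y * (x * x)) (x y z : A) :
    associator x z y = -associator x y z := by
  have h := mul_linearized_right hr x y z
  simp only [associator_apply]
  rw [← sub_eq_zero] at h ⊢
  rw [← h]
  abel

theorem flexible (hl : ∀ x y : A, (x * x) * y = x * (x * y))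
    (hr : ∀ x y : A, (y * x) * x = y * (x * x)) (x y : A) :
    (x * y) * x = x * (y * x) := by
  have h := mul_linearized_left hl x y x
  rw [hr] at h
  rwa [add_left_inj] at h

theorem left_moufang (hl : ∀ x y : A, (x * x) * y = x * (x * y))
    (hr : ∀ x y : A, (y * x) * x = y * (x * x)) (x y z : A) :
    (x * (z * x)) * y = x * (z * (x * y)) := by
  have h₁ := associator_swap_left hl x (x * z) y
  have h₂ := associator_swap_right hr x (x * y) z
  have h₃ := mul_linearized_right hr (x * x) z y
  have h₄ := congrArg (x * ·) (mul_linearized_right hr x z y)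
  simp only [associator_apply, mul_add, hl] at h₁ h₂ h₃ h₄
  rw [flexible hl hr] at h₁
  rw [← sub_eq_zero] at h₁ h₂ h₃ h₄ ⊢
  have h : ∀ p q r s : A, p = 0 → q = 0 → r = 0 → s = 0 → p + q - r + s = 0 := by
    rintro _ _ _ _ rfl rfl rfl rfl
    simp
  rw [← h _ _ _ _ h₁ h₂ h₃ h₄]
  abel

theorem middle_moufang (hl : ∀ x y : A, (x * x) * y = x * (x * y))
    (hr : ∀ x y : A, (y * x) * x = y * (x * x)) (x y z : A) :
    (x * y) * (z * x) = (x * (y * z)) * x := by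
  have h₁ := associator_swap_right hr x y (z * x)
  have h₂ : associator z x y = associator y z x := by
    rw [associator_swap_right hr, associator_swap_left hl, neg_neg]
  have h₃ := congrArg (x * ·) h₂
  simp only [associator_apply, mul_sub, left_moufang hl hr] at h₁ h₃
  rw [flexible hl hr x (y * z)]
  rw [← sub_eq_zero] at h₁ h₃ ⊢
  have h : ∀ p q : A, p = 0 → q = 0 → p + q = 0 := by
    rintro _ _ rfl rfl
    simp
  rw [← h _ _ h₁ h₃]
  abel

theorem inv_mul_cancel_left (hl : ∀ x y : A, (x * x) * y = x * (x * y))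
    (hr : ∀ x y : A, (y * x) * x = y * (x * x)) {x x' : A}
    (h : x * x' = 1) (h' : x' * x = 1) (y : A) : x' * (x * y) = y := by
  have hinj (t : A) : x * (x' * (x' * (x * t))) = t := by
    rw [← hl x', ← left_moufang hl hr, hl, h', mul_one, h, one_mul]
  have hx : x * (x' * (x * y)) = x * y := by
    rw [← left_moufang hl hr, h', mul_one]
  rw [← hinj (x' * (x * y)), hx, hinj]

theorem mul_inv_cancel_right (hl : ∀ x y : A, (x * x) * y = x * (x * y))
    (hr : ∀ x y : A, (y * x) * x = y * (x * x)) {x x' : A}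
    (h : x * x' = 1) (h' : x' * x = 1) (y : A) : (y * x') * x = y :=
  congrArg MulOpposite.unop <| inv_mul_cancel_left (A := Aᵐᵒᵖ)
    (fun s t => congrArg MulOpposite.op (hr s.unop t.unop).symm)
    (fun s t => congrArg MulOpposite.op (hl s.unop t.unop).symm)
    (congrArg MulOpposite.op h) (congrArg MulOpposite.op h') (MulOpposite.op y)

theorem mul_mul_inv_rev (hl : ∀ x y : A, (x * x) * y = x * (x * y))
    (hr : ∀ x y : A, (y * x) * x = y * (x * x)) {x x' y y' : A}
    (hx : x * x' = 1) (hx' : x' * x = 1) (hy : y * y' = 1) (hy' : y' * y = 1) :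
    (x * y) * (y' * x') = 1 := by
  have hz : (y' * (x' * x')) * x = y' * x' := by
    rw [← hr, mul_inv_cancel_right hl hr hx hx']
  rw [← hz, middle_moufang hl hr, inv_mul_cancel_left hl hr hy' hy, ← hr, hx, one_mul, hx']

theorem one_sub_mul_sum_iterate (hl : ∀ x y : A, (x * x) * y = x * (x * y))
    (hr : ∀ x y : A, (y * x) * x = y * (x * x)) {m : ℕ} {u : A}
    (hu : (fun y => y * u)^[m] (1 : A) = 0) :
    (1 - u) * (∑ i ∈ Finset.range m, (fun y => y * u)^[i] (1 : A)) = 1 := by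
  have hcomm (i : ℕ) : u * (fun y => y * u)^[i] (1 : A) = (fun y => y * u)^[i + 1] (1 : A) := by
    induction i with
    | zero => simp
    | succ i ih =>
      rw [Function.iterate_succ_apply', ← flexible hl hr, ih]
      exact (Function.iterate_succ_apply' (fun y => y * u) (i + 1) 1).symm
  simp only [sub_mul, one_mul, Finset.mul_sum, hcomm]
  rw [Finset.sum_range_sub' (fun i => (fun y => y * u)^[i] (1 : A)), hu]
  simp

theorem sum_iterate_mul_one_sub {m : ℕ} {u : A} (hu : (fun y => y * u)^[m] (1 : A) = 0) :
    (∑ i ∈ Finset.range m, (fun y => y * u)^[i] (1 : A)) * (1 - u) = 1 := by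
  have hsucc (i : ℕ) : (fun y => y * u)^[i] (1 : A) * u = (fun y => y * u)^[i + 1] (1 : A) :=
    (Function.iterate_succ_apply' (fun y => y * u) i 1).symm
  simp only [mul_sub, mul_one, Finset.sum_mul, hsucc]
  rw [← Finset.sum_sub_distrib fun i => (fun y => y * u)^[i] (1 : A)]
  rw [Finset.sum_range_sub' (fun i => (fun y => y * u)^[i] (1 : A)), hu]
  simp

end AlternativeRing

/-- Associator formula (Lemma 12): in a unital alternative ring, for `u,v,w` with vanishing
right-normed `m`-th powers and `a = 1 − u`, `b = 1 − v`, `c = 1 − w`, the loop associator of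
`a, b, c` is `1 − ((Sw Sv) Su)(u,v,w)` where `Sx = ∑_{i<m} x^[i]`, i.e.
`(a(bc)) ⬝ (1 − ((Sw Sv) Su)((uv)w − u(vw))) = (ab)c`. -/
theorem alternative_loop_associator_formula {A : Type*} [NonAssocRing A]
    (hl : ∀ x y : A, (x * x) * y = x * (x * y))
    (hr : ∀ x y : A, (y * x) * x = y * (x * x))
    (m : ℕ) (u v w : A)
    (hu : (fun y => y * u)^[m] (1 : A) = 0)
    (hv : (fun y => y * v)^[m] (1 : A) = 0)
    (hw : (fun y => y * w)^[m] (1 : A) = 0) :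
    ((1 - u) * ((1 - v) * (1 - w))) *
      (1 - (((∑ i ∈ Finset.range m, (fun y => y * w)^[i] (1 : A)) *
             (∑ i ∈ Finset.range m, (fun y => y * v)^[i] (1 : A))) *
            (∑ i ∈ Finset.range m, (fun y => y * u)^[i] (1 : A))) *
        ((u * v) * w - u * (v * w))) =
    ((1 - u) * (1 - v)) * (1 - w) := by
  have hau := AlternativeRing.one_sub_mul_sum_iterate hl hr hu
  have hua := AlternativeRing.sum_iterate_mul_one_sub hu
  have hbv := AlternativeRing.one_sub_mul_sum_iterate hl hr hv
  have hvb := AlternativeRing.sum_iterate_mul_one_sub hv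
  have hcw := AlternativeRing.one_sub_mul_sum_iterate hl hr hw
  have hwc := AlternativeRing.sum_iterate_mul_one_sub hw
  have hbc := AlternativeRing.mul_mul_inv_rev hl hr hbv hvb hcw hwc
  have hcb := AlternativeRing.mul_mul_inv_rev hl hr hwc hcw hvb hbv
  have habc := AlternativeRing.mul_mul_inv_rev hl hr hau hua hbc hcb
  have hcba := AlternativeRing.mul_mul_inv_rev hl hr hcb hbc hua hau
  rw [mul_sub, mul_one, AlternativeRing.inv_mul_cancel_left hl hr hcba habc]
  simp only [sub_mul, mul_sub, one_mul, mul_one]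
  abel
end

section
/- (Equation (6), α-part.) In any Moufang loop Q, for all a, b, c in Q, writing t = (a * (b * c))⁻¹ * ((a * b) * c) for the associator of a, b, c, one has (a * t⁻¹) * (c⁻¹ * b⁻¹) = (a * c⁻¹) * b⁻¹. -/
/-- Equation (6), α-part: in any Moufang loop, with `t = (a(bc))⁻¹((ab)c)` the associator
of `a, b, c`, one has `(a t⁻¹)(c⁻¹ b⁻¹) = (a c⁻¹) b⁻¹`. -/
theorem moufang_assoc_alpha {Q : Type*} [Mul Q] [One Q] [Inv Q]
    (one_mul : ∀ x : Q, 1 * x = x) (mul_one : ∀ x : Q, x * 1 = x)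
    (inv_mul_cancel_left : ∀ x y : Q, x⁻¹ * (x * y) = y)
    (mul_inv_cancel_right : ∀ x y : Q, (y * x) * x⁻¹ = y)
    (moufang : ∀ x y z : Q, ((x * y) * x) * z = x * (y * (x * z)))
    (a b c : Q) :
    (a * ((a * (b * c))⁻¹ * ((a * b) * c))⁻¹) * (c⁻¹ * b⁻¹) = (a * c⁻¹) * b⁻¹ := by
  have inv_inv (x : Q) : x⁻¹⁻¹ = x := by
    rw [← mul_one x⁻¹⁻¹, ← inv_mul_cancel_left x 1, inv_mul_cancel_left x⁻¹, mul_one]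
  have mul_inv_cancel_left (x y : Q) : x * (x⁻¹ * y) = y := by
    simpa only [inv_inv] using inv_mul_cancel_left x⁻¹ y
  have inv_mul_cancel_right (x y : Q) : (y * x⁻¹) * x = y := by
    simpa only [inv_inv] using mul_inv_cancel_right x⁻¹ y
  have mul_inv_rev (x y : Q) : (x * y)⁻¹ = y⁻¹ * x⁻¹ := by
    have h : y * (x * y)⁻¹ = x⁻¹ := by
      simpa only [inv_mul_cancel_left] using mul_inv_cancel_right (x * y) x⁻¹
    rw [← h, inv_mul_cancel_left]
  have middle_moufang (x y z : Q) : (x * (y * z)) * x = (x * y) * (z * x) := by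
    have h := moufang x (y * z) (x⁻¹ * z⁻¹)
    rw [mul_inv_cancel_left, mul_inv_cancel_right, ← mul_inv_rev] at h
    rw [← h, inv_mul_cancel_right]
  have h : (a * ((a * b) * c)⁻¹) * a = (a * c⁻¹) * b⁻¹ := by
    rw [mul_inv_rev, mul_inv_rev, middle_moufang, inv_mul_cancel_right]
  rw [mul_inv_rev (a * (b * c))⁻¹, inv_inv, ← moufang, h, ← mul_inv_rev, mul_inv_cancel_right]
end

section
/- (Equation (6), β-part.) In any Moufang loop Q, for all a, b, c in Q, writing t = (a * (b * c))⁻¹ * ((a * b) * c) for the associator of a, b, c, one has (b * c) * (t * a⁻¹) = b * (c * a⁻¹). -/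
/-- Equation (6), β-part: in any Moufang loop, with `t = (a(bc))⁻¹((ab)c)` the associator
of `a, b, c`, one has `(bc)(t a⁻¹) = b (c a⁻¹)`. -/
theorem moufang_assoc_beta {Q : Type*} [Mul Q] [One Q] [Inv Q]
    (one_mul : ∀ x : Q, 1 * x = x) (mul_one : ∀ x : Q, x * 1 = x)
    (inv_mul_cancel_left : ∀ x y : Q, x⁻¹ * (x * y) = y)
    (mul_inv_cancel_right : ∀ x y : Q, (y * x) * x⁻¹ = y)
    (moufang : ∀ x y z : Q, ((x * y) * x) * z = x * (y * (x * z)))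
    (a b c : Q) :
    (b * c) * (((a * (b * c))⁻¹ * ((a * b) * c)) * a⁻¹) = b * (c * a⁻¹) := by
  have inv_inv' (x : Q) : x⁻¹⁻¹ = x := by
    have h := inv_mul_cancel_left x⁻¹ (x * 1)
    rwa [inv_mul_cancel_left x, mul_one, mul_one] at h
  have mul_inv_cancel_left' (x y : Q) : x * (x⁻¹ * y) = y := by
    simpa only [inv_inv'] using inv_mul_cancel_left x⁻¹ y
  have inv_mul_cancel_right' (x y : Q) : (y * x⁻¹) * x = y := by
    simpa only [inv_inv'] using mul_inv_cancel_right x⁻¹ y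
  have mul_inv_rev' (x y : Q) : (x * y)⁻¹ = y⁻¹ * x⁻¹ := by
    have h := inv_mul_cancel_left (x * y) y⁻¹
    rw [mul_inv_cancel_right] at h
    rw [← h, mul_inv_cancel_right]
  have middle_moufang (x y z : Q) : (x * y) * (z * x) = (x * (y * z)) * x := by
    have h := moufang x (y * z) (x⁻¹ * z⁻¹)
    rw [mul_inv_cancel_left', mul_inv_cancel_right, ← mul_inv_rev'] at h
    rw [← h, inv_mul_cancel_right']
  have left_cancel (x y z : Q) (h : x * y = x * z) : y = z := by
    rw [← inv_mul_cancel_left x y, h, inv_mul_cancel_left]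
  have right_cancel (x y z : Q) (h : y * x = z * x) : y = z := by
    rw [← mul_inv_cancel_right x y, h, mul_inv_cancel_right]
  apply left_cancel a
  apply right_cancel a
  rw [← middle_moufang, ← middle_moufang, inv_mul_cancel_right', inv_mul_cancel_right',
    mul_inv_cancel_left']
end
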